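/- arXiv:1511.02165 — 2 statements merged into one kernel-verified Lean document; each statement's English description precedes it below -/
import Mathlib

section
/- For every 0 ≤ a ≤ b, one has R_a ≥ R_b (monotonicity of the maximal existence radius). -/
open MeasureTheory Real Filter Set
open scoped ENNReal Topology

noncomputable section

/-- The interval [0, R) for an extended-real radius `R`. -/
def odeDom (R : ℝ≥0∞) : Set ℝ := {r : ℝ | 0 ≤ r ∧ ENNReal.ofReal r < R}

/-- `u` is a solution with initial value `a` on `[0, R)` of
u'' + ((m-1)/r) u' = φ(u), u(0) = a, u'(0) = 0, with `u` nonnegative and C². -/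
def IsSolOn (m : ℝ) (φ : ℝ → ℝ) (a : ℝ) (R : ℝ≥0∞) (u : ℝ → ℝ) : Prop :=
  ContDiffOn ℝ 2 u (odeDom R) ∧
  (∀ r ∈ odeDom R, 0 ≤ u r) ∧
  u 0 = a ∧
  derivWithin u (Set.Ici 0) 0 = 0 ∧
  ∀ r : ℝ, 0 < r → ENNReal.ofReal r < R →
    deriv (deriv u) r + ((m - 1) / r) * deriv u r = φ (u r)

/-- The maximal existence radius `R_a`: the supremum of all `R ∈ (0, ∞]` such that a solution
with initial value `a` exists on `[0, R)`. -/
def maxRadius (m : ℝ) (φ : ℝ → ℝ) (a : ℝ) : ℝ≥0∞ :=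
  sSup {R : ℝ≥0∞ | 0 < R ∧ ∃ u : ℝ → ℝ, IsSolOn m φ a R u}

/-- The weighted mean `∫₀¹ τ ^ (m - 1) f (r τ) dτ`, that is `r ^ (-m) ∫₀ʳ t ^ (m - 1) f t dt`. -/
def radialMean (m : ℝ) (f : ℝ → ℝ) (r : ℝ) : ℝ :=
  ∫ τ in (0 : ℝ)..1, τ ^ (m - 1) * f (r * τ)

/-- The solution operator of `u'' + ((m - 1) / r) u' = f`, `u 0 = a`, `u' 0 = 0`. -/
def radialPotential (m a : ℝ) (f : ℝ → ℝ) (r : ℝ) : ℝ :=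
  a + r ^ 2 * radialMean 2 (radialMean m f) r

section RadialMean

variable {m : ℝ} {f g : ℝ → ℝ}

lemma continuous_weight (hm : 1 < m) : Continuous fun τ : ℝ => τ ^ (m - 1) :=
  Real.continuous_rpow_const (by linarith)

lemma continuous_radialMean_integrand (hm : 1 < m) (hf : Continuous f) (r : ℝ) :
    Continuous fun τ : ℝ => τ ^ (m - 1) * f (r * τ) :=
  (continuous_weight hm).mul (by fun_prop)

lemma continuous_radialMean (hm : 1 < m) (hf : Continuous f) : Continuous (radialMean m f) := by
  have := continuous_weight hm
  refine intervalIntegral.continuous_parametric_intervalIntegral_of_continuous'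
    (f := fun r τ => τ ^ (m - 1) * f (r * τ)) ?_ 0 1
  exact (this.comp continuous_snd).mul (by fun_prop)

lemma radialMean_mono (hm : 1 < m) (hf : Continuous f) (hg : Continuous g) (h : f ≤ g) :
    radialMean m f ≤ radialMean m g := fun r =>
  intervalIntegral.integral_mono_on zero_le_one
    ((continuous_radialMean_integrand hm hf r).intervalIntegrable _ _)
    ((continuous_radialMean_integrand hm hg r).intervalIntegrable _ _)
    fun _ hτ => mul_le_mul_of_nonneg_left (h _) (Real.rpow_nonneg hτ.1 _)

lemma radialMean_nonneg (hf : 0 ≤ f) : 0 ≤ radialMean m f := fun _ =>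
  intervalIntegral.integral_nonneg zero_le_one
    fun _ hτ => mul_nonneg (Real.rpow_nonneg hτ.1 _) (hf _)

lemma norm_weight_mul_le (hm : 1 < m) {K τ y : ℝ} (hτ : τ ∈ uIoc (0 : ℝ) 1) (hy : ‖y‖ ≤ K) :
    ‖τ ^ (m - 1) * y‖ ≤ K := by
  rw [uIoc_of_le zero_le_one] at hτ
  rw [norm_mul, Real.norm_of_nonneg (Real.rpow_nonneg hτ.1.le _)]
  exact (mul_le_of_le_one_left (norm_nonneg _)
    (Real.rpow_le_one hτ.1.le hτ.2 (by linarith))).trans hy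

lemma norm_radialMean_le (hm : 1 < m) {K : ℝ} (hf : ∀ x, ‖f x‖ ≤ K) (r : ℝ) :
    ‖radialMean m f r‖ ≤ K := by
  have := intervalIntegral.norm_integral_le_of_norm_le_const (a := 0) (b := 1)
    (f := fun τ => τ ^ (m - 1) * f (r * τ)) (C := K)
    fun τ hτ => norm_weight_mul_le hm hτ (hf _)
  simpa [radialMean] using this

lemma tendsto_radialMean (hm : 1 < m) {F : ℕ → ℝ → ℝ} {K : ℝ} (hF : ∀ n, Continuous (F n))
    (hK : ∀ n x, ‖F n x‖ ≤ K) (hlim : ∀ x, Tendsto (fun n => F n x) atTop (𝓝 (f x))) (r : ℝ) :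
    Tendsto (fun n => radialMean m (F n) r) atTop (𝓝 (radialMean m f r)) := by
  refine intervalIntegral.tendsto_integral_filter_of_dominated_convergence (fun _ => K) ?_ ?_ ?_ ?_
  · exact Eventually.of_forall fun n =>
      (continuous_radialMean_integrand hm (hF n) r).aestronglyMeasurable
  · exact Eventually.of_forall fun n => Eventually.of_forall fun τ hτ =>
      norm_weight_mul_le hm hτ (hK _ _)
  · exact intervalIntegrable_const
  · exact Eventually.of_forall fun τ _ => (hlim _).const_mul _

lemma radialMean_zero_right (hm : 1 < m) : radialMean m f 0 = f 0 / m := by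
  simp only [radialMean, zero_mul, intervalIntegral.integral_mul_const]
  rw [integral_rpow (Or.inl (by linarith))]
  have : m ≠ 0 := by linarith
  simp [this]
  ring

lemma radialMean_comp_neg (r : ℝ) : radialMean m (fun x => f (-x)) (-r) = radialMean m f r := by
  simp [radialMean]

lemma mul_radialMean_of_pos {r : ℝ} (hr : 0 < r) :
    r * radialMean m f r = r ^ (1 - m) * ∫ t in (0 : ℝ)..r, t ^ (m - 1) * f t := by
  have key := intervalIntegral.mul_integral_comp_mul_left (a := 0) (b := 1)
    (f := fun t => t ^ (m - 1) * f t) r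
  simp only [mul_zero, mul_one] at key
  rw [← key, radialMean, mul_left_comm (r ^ (1 - m)),
    ← intervalIntegral.integral_const_mul (r ^ (1 - m))]
  refine congrArg (r * ·) (intervalIntegral.integral_congr (μ := volume) fun τ hτ => ?_)
  rw [uIcc_of_le zero_le_one] at hτ
  rw [Real.mul_rpow hr.le hτ.1, ← mul_assoc, ← mul_assoc, ← Real.rpow_add hr]
  simp

lemma hasDerivAt_mul_radialMean_of_pos (hm : 1 < m) (hf : Continuous f) {r : ℝ} (hr : 0 < r) :
    HasDerivAt (fun s => s * radialMean m f s) (f r - (m - 1) * radialMean m f r) r := by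
  have hc : Continuous fun t : ℝ => t ^ (m - 1) * f t := (continuous_weight hm).mul hf
  have h1 : HasDerivAt (fun s => ∫ t in (0 : ℝ)..s, t ^ (m - 1) * f t) (r ^ (m - 1) * f r) r :=
    hc.integral_hasStrictDerivAt 0 r |>.hasDerivAt
  have h2 : HasDerivAt (fun s : ℝ => s ^ (1 - m)) ((1 - m) * r ^ (1 - m - 1)) r :=
    Real.hasDerivAt_rpow_const (Or.inl hr.ne')
  have h3 := (h2.mul h1).congr_of_eventuallyEq (f₁ := fun s => s * radialMean m f s)
    (by filter_upwards [lt_mem_nhds hr] with s hs using mul_radialMean_of_pos hs)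
  refine h3.congr_deriv ?_
  have e1 : r ^ (1 - m) * r ^ (m - 1) = 1 := by rw [← Real.rpow_add hr]; simp
  have e2 : r ^ (1 - m - 1) = r ^ (1 - m) / r := by rw [Real.rpow_sub_one hr.ne']
  have e3 := mul_radialMean_of_pos (m := m) (f := f) hr
  rw [e2, ← mul_assoc (r ^ (1 - m)), e1, mul_assoc (1 - m), div_mul_eq_mul_div, ← e3]
  have hr0 := hr.ne'
  field_simp
  ring

lemma hasDerivAt_mul_radialMean (hm : 1 < m) (hf : Continuous f) (r : ℝ) :
    HasDerivAt (fun s => s * radialMean m f s) (f r - (m - 1) * radialMean m f r) r := by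
  rcases lt_trichotomy r 0 with hr | rfl | hr
  · have h := hasDerivAt_mul_radialMean_of_pos hm (f := fun x => f (-x)) (by fun_prop)
      (neg_pos.2 hr)
    have h' := (h.scomp r (hasDerivAt_neg r)).neg
    refine (h'.congr_of_eventuallyEq (Eventually.of_forall fun s => ?_)).congr_deriv ?_
    · simp [radialMean_comp_neg]
    · simp [radialMean_comp_neg]
  · rw [hasDerivAt_iff_tendsto_slope]
    have h : Tendsto (radialMean m f) (𝓝[≠] 0) (𝓝 (radialMean m f 0)) :=
      (continuous_radialMean hm hf).continuousAt.tendsto.mono_left nhdsWithin_le_nhds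
    have e : f 0 - (m - 1) * radialMean m f 0 = radialMean m f 0 := by
      rw [radialMean_zero_right hm]
      field_simp
      ring
    rw [e]
    refine h.congr' ?_
    filter_upwards [self_mem_nhdsWithin] with s hs
    have hs' : s ≠ 0 := hs
    simp [slope_def_field, hs']
  · exact hasDerivAt_mul_radialMean_of_pos hm hf hr

lemma sq_mul_radialMean_two (r : ℝ) :
    r ^ 2 * radialMean 2 g r = ∫ s in (0 : ℝ)..r, s * g s := by
  have key := intervalIntegral.mul_integral_comp_mul_left (a := 0) (b := 1)
    (f := fun t => t * g t) r
  simp only [mul_zero, mul_one] at key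
  rw [← key, radialMean, pow_two, mul_assoc, ← intervalIntegral.integral_const_mul]
  norm_num [mul_assoc]

end RadialMean

section RadialPotential

variable {m a : ℝ} {f : ℝ → ℝ}

lemma hasDerivAt_radialPotential (hm : 1 < m) (hf : Continuous f) (r : ℝ) :
    HasDerivAt (radialPotential m a f) (r * radialMean m f r) r := by
  have hc : Continuous fun s => s * radialMean m f s :=
    continuous_id.mul (continuous_radialMean hm hf)
  have h := (hc.integral_hasStrictDerivAt 0 r).hasDerivAt.const_add a
  refine h.congr_of_eventuallyEq (Eventually.of_forall fun s => ?_)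
  rw [radialPotential, sq_mul_radialMean_two]

lemma continuous_radialPotential (hm : 1 < m) (hf : Continuous f) :
    Continuous (radialPotential m a f) :=
  continuous_iff_continuousAt.2 fun r => (hasDerivAt_radialPotential hm hf r).continuousAt

lemma deriv_radialPotential (hm : 1 < m) (hf : Continuous f) :
    deriv (radialPotential m a f) = fun r => r * radialMean m f r :=
  funext fun r => (hasDerivAt_radialPotential hm hf r).deriv

lemma contDiff_radialPotential (hm : 1 < m) (hf : Continuous f) :
    ContDiff ℝ 2 (radialPotential m a f) := by
  have h1 : ContDiff ℝ 1 fun r => r * radialMean m f r := by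
    rw [contDiff_one_iff_deriv]
    refine ⟨fun r => (hasDerivAt_mul_radialMean hm hf r).differentiableAt, ?_⟩
    rw [funext fun r => (hasDerivAt_mul_radialMean hm hf r).deriv]
    exact hf.sub (continuous_const.mul (continuous_radialMean hm hf))
  rw [show (2 : WithTop ℕ∞) = 1 + 1 by norm_num, contDiff_succ_iff_deriv]
  refine ⟨fun r => (hasDerivAt_radialPotential hm hf r).differentiableAt, by simp, ?_⟩
  rwa [deriv_radialPotential hm hf]

lemma radialPotential_zero_right : radialPotential m a f 0 = a := by
  simp [radialPotential]

lemma radialPotential_mono (hm : 1 < m) {g : ℝ → ℝ} (hf : Continuous f) (hg : Continuous g)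
    (h : f ≤ g) : radialPotential m a f ≤ radialPotential m a g := fun r => by
  have := radialMean_mono one_lt_two (continuous_radialMean hm hf) (continuous_radialMean hm hg)
    (radialMean_mono hm hf hg h) r
  unfold radialPotential
  gcongr

lemma radialPotential_nonneg (ha : 0 ≤ a) (hf : 0 ≤ f) : 0 ≤ radialPotential m a f := fun r =>
  add_nonneg ha (mul_nonneg (sq_nonneg r) (radialMean_nonneg (radialMean_nonneg hf) r))

lemma radialPotential_le (hm : 1 < m) {K : ℝ} (hf : ∀ x, ‖f x‖ ≤ K) (r : ℝ) :
    radialPotential m a f r ≤ a + r ^ 2 * K := by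
  have := (le_abs_self _).trans
    (norm_radialMean_le one_lt_two (fun x => norm_radialMean_le hm hf x) r)
  unfold radialPotential
  gcongr

lemma tendsto_radialPotential (hm : 1 < m) {F : ℕ → ℝ → ℝ} {K : ℝ} (hF : ∀ n, Continuous (F n))
    (hK : ∀ n x, ‖F n x‖ ≤ K) (hlim : ∀ x, Tendsto (fun n => F n x) atTop (𝓝 (f x))) (r : ℝ) :
    Tendsto (fun n => radialPotential m a (F n) r) atTop (𝓝 (radialPotential m a f r)) :=
  ((tendsto_radialMean one_lt_two (fun n => continuous_radialMean hm (hF n))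
    (fun n x => norm_radialMean_le hm (hK n) x)
    (fun x => tendsto_radialMean hm hF hK hlim x) r).const_mul _).const_add _

lemma continuous_radialPotential_of_tendsto (hm : 1 < m) {F : ℕ → ℝ → ℝ} {K : ℝ}
    (hF : ∀ n, Continuous (F n)) (hK : ∀ n x, ‖F n x‖ ≤ K)
    (hlim : ∀ x, Tendsto (fun n => F n x) atTop (𝓝 (f x))) :
    Continuous (radialPotential m a f) := by
  have hmeas : Measurable (radialMean m f) :=
    measurable_of_tendsto_metrizable (fun n => (continuous_radialMean hm (hF n)).measurable)
      (tendsto_pi_nhds.2 fun x => tendsto_radialMean hm hF hK hlim x)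
  have hbound : ∀ x, ‖radialMean m f x‖ ≤ K := fun x =>
    norm_radialMean_le hm
      (fun y => le_of_tendsto (hlim y).norm (Eventually.of_forall fun n => hK n y)) x
  have hint : ∀ x y : ℝ, IntervalIntegrable (fun s => s * radialMean m f s) volume x y := by
    intro x y
    have h1 : IntervalIntegrable (radialMean m f) volume x y :=
      (intervalIntegrable_const (c := K)).mono_fun hmeas.aestronglyMeasurable
        (Eventually.of_forall fun s => (hbound s).trans (le_abs_self K))
    exact h1.continuousOn_mul continuousOn_id
  have := (intervalIntegral.continuous_primitive hint 0).const_add a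
  convert this using 2 with s
  rw [radialPotential, sq_mul_radialMean_two]

end RadialPotential

/-- The monotone iteration `w ↦ radialPotential m a (ψ ∘ w)` started at `0`. -/
def radialIterate (m a : ℝ) (ψ : ℝ → ℝ) : ℕ → ℝ → ℝ
  | 0 => fun _ => 0
  | n + 1 => radialPotential m a (fun x => ψ (radialIterate m a ψ n x))

section RadialIterate

variable {m a : ℝ} {ψ : ℝ → ℝ}

lemma continuous_radialIterate (hm : 1 < m) (hψ : Continuous ψ) :
    ∀ n, Continuous (radialIterate m a ψ n)
  | 0 => continuous_const
  | n + 1 => continuous_radialPotential hm (hψ.comp (continuous_radialIterate hm hψ n))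

lemma monotone_radialIterate (hm : 1 < m) (ha : 0 ≤ a) (hψ : Continuous ψ) (hmono : Monotone ψ)
    (hnonneg : ∀ x, 0 ≤ ψ x) : Monotone (radialIterate m a ψ) := by
  refine monotone_nat_of_le_succ fun n => ?_
  induction n with
  | zero => exact radialPotential_nonneg ha fun x => hnonneg _
  | succ n ih =>
    exact radialPotential_mono hm (hψ.comp (continuous_radialIterate hm hψ n))
      (hψ.comp (continuous_radialIterate hm hψ (n + 1))) fun x => hmono (ih x)

theorem exists_tendsto_radialIterate (hm : 1 < m) (ha : 0 ≤ a) (hψ : Continuous ψ)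
    (hmono : Monotone ψ) (hnonneg : ∀ x, 0 ≤ ψ x) {K : ℝ} (hK : ∀ x, ψ x ≤ K) :
    ∃ u : ℝ → ℝ, Continuous u ∧ (∀ r, 0 ≤ u r) ∧ u = radialPotential m a (fun x => ψ (u x)) ∧
      ∀ r, Tendsto (fun n => radialIterate m a ψ n r) atTop (𝓝 (u r)) := by
  have hnorm : ∀ x, ‖ψ x‖ ≤ K := fun x => by
    rw [Real.norm_of_nonneg (hnonneg x)]
    exact hK x
  have hincr := monotone_radialIterate hm ha hψ hmono hnonneg
  have hbdd : ∀ r, BddAbove (range fun n => radialIterate m a ψ n r) := fun r => by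
    refine ⟨a + r ^ 2 * K, ?_⟩
    rintro _ ⟨n, rfl⟩
    exact (hincr n.le_succ r).trans (radialPotential_le hm (fun x => hnorm _) r)
  have hlim : ∀ r, Tendsto (fun n => radialIterate m a ψ n r) atTop
      (𝓝 (⨆ n, radialIterate m a ψ n r)) := fun r =>
    tendsto_atTop_ciSup (fun _ _ h => hincr h r) (hbdd r)
  set u : ℝ → ℝ := fun r => ⨆ n, radialIterate m a ψ n r
  have hcont n : Continuous fun x => ψ (radialIterate m a ψ n x) :=
    hψ.comp (continuous_radialIterate hm hψ n)
  have hψlim x : Tendsto (fun n => ψ (radialIterate m a ψ n x)) atTop (𝓝 (ψ (u x))) :=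
    (hψ.tendsto _).comp (hlim x)
  have hfix : u = radialPotential m a (fun x => ψ (u x)) := funext fun r =>
    tendsto_nhds_unique ((tendsto_add_atTop_iff_nat 1).2 (hlim r))
      (tendsto_radialPotential hm hcont (fun n x => hnorm _) hψlim r)
  refine ⟨u, ?_, fun r => le_ciSup (hbdd r) 0, hfix, hlim⟩
  rw [hfix]
  exact continuous_radialPotential_of_tendsto hm hcont (fun n x => hnorm _) hψlim

end RadialIterate

/-- Comparison of a radial potential with a solution of a larger radial equation. -/
lemma radialPotential_le_of_le {m a b ρ : ℝ} (hm : 1 < m) (hab : a ≤ b) {f g v : ℝ → ℝ}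
    (hf : Continuous f) (hρ : 0 < ρ) (hv : ContDiffOn ℝ 2 v (Icc 0 ρ)) (hv0 : v 0 = b)
    (heq : ∀ r ∈ Ioo 0 ρ, deriv (deriv v) r + ((m - 1) / r) * deriv v r = g r)
    (hfg : ∀ r ∈ Ioo 0 ρ, f r ≤ g r) :
    ∀ r ∈ Icc 0 ρ, radialPotential m a f r ≤ v r := by
  set V := derivWithin v (Icc 0 ρ)
  have hVc : ContinuousOn V (Icc 0 ρ) :=
    hv.continuousOn_derivWithin (uniqueDiffOn_Icc hρ) (by norm_num)
  have hVeq : ∀ r ∈ Ioo 0 ρ, V r = deriv v r := fun r hr =>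
    derivWithin_of_mem_nhds (Icc_mem_nhds hr.1 hr.2)
  have hvd : ∀ r ∈ Ioo 0 ρ, HasDerivAt v (deriv v r) r := fun r hr =>
    ((hv.contDiffAt (Icc_mem_nhds hr.1 hr.2)).differentiableAt (by norm_num)).hasDerivAt
  have hvdd : ∀ r ∈ Ioo 0 ρ, HasDerivAt V (deriv (deriv v) r) r := fun r hr => by
    have h1 : ContDiffOn ℝ 1 (deriv v) (Ioo 0 ρ) :=
      (hv.mono Ioo_subset_Icc_self).deriv_of_isOpen isOpen_Ioo (by norm_num)
    have h2 := ((h1.contDiffAt (Ioo_mem_nhds hr.1 hr.2)).differentiableAt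
      (by norm_num)).hasDerivAt
    exact h2.congr_of_eventuallyEq
      (by filter_upwards [Ioo_mem_nhds hr.1 hr.2] with s hs using hVeq s hs)
  have hflux : MonotoneOn (fun r => r ^ (m - 1) * (V r - r * radialMean m f r)) (Icc 0 ρ) := by
    refine monotoneOn_of_hasDerivWithinAt_nonneg (convex_Icc 0 ρ)
      (f' := fun r => r ^ (m - 1) * (g r - f r)) ?_ ?_ ?_
    · exact (continuous_weight hm).continuousOn.mul
        (hVc.sub (continuous_id.mul (continuous_radialMean hm hf)).continuousOn)
    · intro r hr
      rw [interior_Icc] at hr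
      refine HasDerivAt.hasDerivWithinAt ?_
      have h1 : HasDerivAt (fun s : ℝ => s ^ (m - 1)) ((m - 1) * r ^ (m - 1 - 1)) r :=
        Real.hasDerivAt_rpow_const (Or.inl hr.1.ne')
      refine (h1.mul ((hvdd r hr).sub (hasDerivAt_mul_radialMean hm hf r))).congr_deriv ?_
      have hr0 := hr.1.ne'
      simp only [Pi.sub_apply]
      rw [← heq r hr, Real.rpow_sub_one hr0, hVeq r hr]
      field_simp
      ring
    · intro r hr
      rw [interior_Icc] at hr
      exact mul_nonneg (Real.rpow_nonneg hr.1.le _) (sub_nonneg.2 (hfg r hr))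
  have hdiff : MonotoneOn (fun r => v r - radialPotential m a f r) (Icc 0 ρ) := by
    refine monotoneOn_of_hasDerivWithinAt_nonneg (convex_Icc 0 ρ)
      (f' := fun r => V r - r * radialMean m f r) ?_ ?_ ?_
    · exact hv.continuousOn.sub (continuous_radialPotential hm hf).continuousOn
    · intro r hr
      rw [interior_Icc] at hr
      rw [hVeq r hr]
      exact ((hvd r hr).sub (hasDerivAt_radialPotential hm hf r)).hasDerivWithinAt
    · intro r hr
      rw [interior_Icc] at hr
      have h := hflux (left_mem_Icc.2 hρ.le) (Ioo_subset_Icc_self hr) hr.1.le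
      simp only [Real.zero_rpow (sub_pos.2 hm).ne', zero_mul] at h
      exact nonneg_of_mul_nonneg_right h (Real.rpow_pos_of_pos hr.1 _)
  intro r hr
  have h := hdiff (left_mem_Icc.2 hρ.le) hr hr.1
  simp only [hv0, radialPotential_zero_right] at h
  linarith

lemma exists_isSolOn_of_lt {m : ℝ} (hm : 1 < m) {φ : ℝ → ℝ} (hcont : ContinuousOn φ (Ici 0))
    (hφmono : MonotoneOn φ (Ici 0)) (hφnonneg : ∀ t : ℝ, 0 ≤ t → 0 ≤ φ t) {a b : ℝ}
    (ha : 0 ≤ a) (hab : a ≤ b) {R : ℝ≥0∞} {v : ℝ → ℝ} (hv : IsSolOn m φ b R v) {ρ : ℝ}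
    (hρ : 0 < ρ) (hρR : ENNReal.ofReal ρ < R) :
    ∃ u : ℝ → ℝ, IsSolOn m φ a (ENNReal.ofReal ρ) u := by
  obtain ⟨hvC, hv_nonneg, hv0, -, hv_eq⟩ := hv
  have hsub : Icc 0 ρ ⊆ odeDom R := fun r hr =>
    ⟨hr.1, (ENNReal.ofReal_le_ofReal hr.2).trans_lt hρR⟩
  have hvC' := hvC.mono hsub
  obtain ⟨C, hC⟩ := isCompact_Icc.bddAbove_image hvC'.continuousOn
  have hvle : ∀ r ∈ Icc 0 ρ, v r ≤ C := fun r hr => hC (mem_image_of_mem v hr)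
  have hC0 : 0 ≤ C := (hv_nonneg 0 (hsub (left_mem_Icc.2 hρ.le))).trans
    (hvle 0 (left_mem_Icc.2 hρ.le))
  -- The truncation of `φ` to `[0, C]` is bounded and agrees with `φ` along the range of `v`.
  set ψ : ℝ → ℝ := fun t => φ (max 0 (min t C)) with hψdef
  have hclamp t : max 0 (min t C) ∈ Ici (0 : ℝ) := mem_Ici.2 (le_max_left _ _)
  have hψ : Continuous ψ := hcont.comp_continuous (by fun_prop) hclamp
  have hψmono : Monotone ψ := fun s t hst =>
    hφmono (hclamp s) (hclamp t) (max_le_max le_rfl (min_le_min hst le_rfl))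
  have hψeq : ∀ t, 0 ≤ t → t ≤ C → ψ t = φ t := fun t h0 h1 => by
    simp [hψdef, min_eq_left h1, max_eq_right h0]
  obtain ⟨u, hu, hu0, hfix, hlim⟩ := exists_tendsto_radialIterate hm ha hψ hψmono
    (fun t => hφnonneg _ (hclamp t))
    (fun t => hφmono (hclamp t) hC0 (max_le hC0 (min_le_right _ _)))
  have hle n : ∀ r ∈ Icc 0 ρ, radialIterate m a ψ n r ≤ v r := by
    induction n with
    | zero => exact fun r hr => hv_nonneg r (hsub hr)
    | succ n ih =>
      refine radialPotential_le_of_le hm hab (hψ.comp (continuous_radialIterate hm hψ n)) hρ hvC'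
        hv0 (g := fun r => φ (v r)) (fun r hr => ?_) fun r hr => ?_
      · exact hv_eq r hr.1 (hsub (Ioo_subset_Icc_self hr)).2
      · have hr' := Ioo_subset_Icc_self hr
        exact (hψmono (ih r hr')).trans_eq (hψeq _ (hv_nonneg r (hsub hr')) (hvle r hr'))
  have huC : ∀ r ∈ Icc 0 ρ, u r ≤ C := fun r hr =>
    (le_of_tendsto' (hlim r) fun n => hle n r hr).trans (hvle r hr)
  have hψu : Continuous fun x => ψ (u x) := hψ.comp hu
  have hd : deriv u = fun r => r * radialMean m (fun x => ψ (u x)) r := by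
    conv_lhs => rw [hfix]
    exact deriv_radialPotential hm hψu
  have hC2 : ContDiff ℝ 2 u := by
    rw [hfix]
    exact contDiff_radialPotential hm hψu
  refine ⟨u, hC2.contDiffOn, fun r _ => hu0 r, ?_, ?_, fun r hr hrρ => ?_⟩
  · rw [hfix, radialPotential_zero_right]
  · rw [((hC2.differentiable (by norm_num)) 0).derivWithin (uniqueDiffOn_Ici 0 0 self_mem_Ici), hd]
    simp
  · have hrρ' : r ≤ ρ := ((ENNReal.ofReal_lt_ofReal_iff hρ).1 hrρ).le
    rw [hd, (hasDerivAt_mul_radialMean hm hψu r).deriv, hψeq _ (hu0 r) (huC r ⟨hr.le, hrρ'⟩)]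
    field_simp
    ring

/-- the maximal existence radius is nonincreasing in the initial value. -/
theorem maxRadius_antitone
    (m : ℝ) (hm : 2 < m)
    (φ : ℝ → ℝ) (hφ0 : φ 0 = 0)
    (hφmono : MonotoneOn φ (Set.Ici 0))
    (hφnonneg : ∀ t : ℝ, 0 ≤ t → 0 ≤ φ t)
    (hφlip : ∀ x ∈ Set.Ici (0 : ℝ), ∃ K : NNReal, ∃ s ∈ nhdsWithin x (Set.Ici 0),
      LipschitzOnWith K φ s)
 :
    ∀ a b : ℝ, 0 ≤ a → a ≤ b → maxRadius m φ b ≤ maxRadius m φ a := by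
  intro a b ha hab
  have hcont : ContinuousOn φ (Ici 0) := fun x hx => by
    obtain ⟨K, s, hs, hK⟩ := hφlip x hx
    exact (hK.continuousOn x (mem_of_mem_nhdsWithin hx hs)).mono_of_mem_nhdsWithin hs
  refine sSup_le ?_
  rintro R ⟨-, v, hv⟩
  refine le_of_forall_lt fun c hc => ?_
  obtain ⟨c', hcc', hc'R⟩ := exists_between hc
  have hc'top : c' ≠ ⊤ := hc'R.ne_top
  have hc'pos : 0 < c' := bot_le.trans_lt hcc'
  have hof := ENNReal.ofReal_toReal hc'top
  obtain ⟨u, hu⟩ := exists_isSolOn_of_lt (by linarith) hcont hφmono hφnonneg ha hab hv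
    (ENNReal.toReal_pos hc'pos.ne' hc'top) (hof.trans_lt hc'R)
  rw [hof] at hu
  exact hcc'.trans_le (le_sSup ⟨hc'pos, u, hu⟩)
end
end

section
/- For every a > 0, as extended reals, ∫_a^∞ dt/√(∫_a^t φ(s) ds) ≤ √2 · R_a ≤ √m · ∫_a^∞ dt/√(∫_a^t φ(s) ds), with the convention that the integrand equals +∞ where ∫_a^t φ(s) ds = 0. -/
open MeasureTheory Real Filter Set
open scoped ENNReal Topology

noncomputable section

/-- The first-order form `u' = v`, `v' + ((m-1)/r) v = φ(u)`, `v(0) = 0` of the radial equation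
on `[0, ρ]`. -/
structure IsRadialFlow (m : ℝ) (φ : ℝ → ℝ) (ρ : ℝ) (u v : ℝ → ℝ) : Prop where
  continuousOn_fst : ContinuousOn u (Icc 0 ρ)
  continuousOn_snd : ContinuousOn v (Icc 0 ρ)
  snd_zero : v 0 = 0
  hasDerivAt_fst : ∀ r ∈ Ioo 0 ρ, HasDerivAt u (v r) r
  hasDerivAt_snd : ∀ r ∈ Ioo 0 ρ, HasDerivAt v (φ (u r) - (m - 1) / r * v r) r

/-- A nonnegative derivative in the open interval gives monotonicity on the closed one. -/
theorem monotoneOn_Icc_of_hasDerivAt_nonneg {f f' : ℝ → ℝ} {b c : ℝ}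
    (hf : ContinuousOn f (Icc b c)) (hd : ∀ x ∈ Ioo b c, HasDerivAt f (f' x) x)
    (h0 : ∀ x ∈ Ioo b c, 0 ≤ f' x) : MonotoneOn f (Icc b c) :=
  monotoneOn_of_hasDerivWithinAt_nonneg (convex_Icc b c) hf
    (fun x hx => (hd x (by simpa using hx)).hasDerivWithinAt)
    (fun x hx => h0 x (by simpa using hx))

namespace IsRadialFlow

variable {m ρ : ℝ} {φ u v : ℝ → ℝ}

theorem mono (h : IsRadialFlow m φ ρ u v) {r : ℝ} (hr : r ≤ ρ) : IsRadialFlow m φ r u v where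
  continuousOn_fst := h.continuousOn_fst.mono (Icc_subset_Icc_right hr)
  continuousOn_snd := h.continuousOn_snd.mono (Icc_subset_Icc_right hr)
  snd_zero := h.snd_zero
  hasDerivAt_fst s hs := h.hasDerivAt_fst s ⟨hs.1, hs.2.trans_le hr⟩
  hasDerivAt_snd s hs := h.hasDerivAt_snd s ⟨hs.1, hs.2.trans_le hr⟩

/-- The flux `r ^ (m-1) * v` corrected by `c * r ^ m / m` has derivative
`r ^ (m-1) * (φ(u) - c)`. -/
theorem hasDerivAt_flux_sub (hm : 1 < m) (h : IsRadialFlow m φ ρ u v) (c : ℝ) {r : ℝ}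
    (hr : r ∈ Ioo 0 ρ) :
    HasDerivAt (fun s => s ^ (m - 1) * v s - c / m * s ^ m) (r ^ (m - 1) * (φ (u r) - c)) r := by
  have h1 := (Real.hasDerivAt_rpow_const (p := m - 1) (Or.inl hr.1.ne')).mul
    (h.hasDerivAt_snd r hr)
  have h2 := (Real.hasDerivAt_rpow_const (x := r) (p := m) (Or.inl hr.1.ne')).const_mul (c / m)
  refine (h1.sub h2).congr_deriv ?_
  have e : r ^ (m - 1) = r ^ (m - 1 - 1) * r := by
    rw [← Real.rpow_add_one hr.1.ne']; congr 1; ring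
  rw [e]
  have := hr.1.ne'
  field_simp
  ring

theorem continuousOn_flux_sub (hm : 1 < m) (h : IsRadialFlow m φ ρ u v) (c : ℝ) :
    ContinuousOn (fun s => s ^ (m - 1) * v s - c / m * s ^ m) (Icc 0 ρ) :=
  ((Real.continuous_rpow_const (by linarith)).continuousOn.mul h.continuousOn_snd).sub
    (((Real.continuous_rpow_const (by linarith)).const_mul _).continuousOn)

theorem le_snd_of_le (hm : 1 < m) (h : IsRadialFlow m φ ρ u v) {c : ℝ}
    (hc : ∀ s ∈ Ioo 0 ρ, c ≤ φ (u s)) {r : ℝ} (hr : r ∈ Icc 0 ρ) : r * c / m ≤ v r := by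
  rcases hr.1.eq_or_lt with h0 | h0
  · simp [← h0, h.snd_zero]
  have hmono := monotoneOn_Icc_of_hasDerivAt_nonneg (h.continuousOn_flux_sub hm c)
    (fun s hs => h.hasDerivAt_flux_sub hm c hs)
    (fun s hs => mul_nonneg (Real.rpow_nonneg hs.1.le _) (sub_nonneg.2 (hc s hs)))
  have := hmono ⟨le_rfl, hr.1.trans hr.2⟩ hr hr.1
  simp only [h.snd_zero, Real.zero_rpow (by linarith : m ≠ 0), mul_zero, sub_zero] at this
  have e : r ^ m = r ^ (m - 1) * r := by rw [← Real.rpow_add_one h0.ne', sub_add_cancel]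
  rw [e] at this
  have hp : 0 < r ^ (m - 1) := Real.rpow_pos_of_pos h0 _
  refine le_of_mul_le_mul_left ?_ hp
  have e2 : r ^ (m - 1) * (r * c / m) = c / m * (r ^ (m - 1) * r) := by ring
  linarith

theorem snd_le_of_le (hm : 1 < m) (h : IsRadialFlow m φ ρ u v) {c : ℝ}
    (hc : ∀ s ∈ Ioo 0 ρ, φ (u s) ≤ c) {r : ℝ} (hr : r ∈ Icc 0 ρ) : v r ≤ r * c / m := by
  have h' : IsRadialFlow m (fun t => -φ (-t)) ρ (-u) (-v) :=
    ⟨h.continuousOn_fst.neg, h.continuousOn_snd.neg, by simp [h.snd_zero],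
      fun s hs => (h.hasDerivAt_fst s hs).neg,
      fun s hs => (h.hasDerivAt_snd s hs).neg.congr_deriv (by simp [neg_add_eq_sub])⟩
  have := h'.le_snd_of_le hm (c := -c) (fun s hs => by simpa using hc s hs) hr
  simp only [Pi.neg_apply] at this
  have e : r * -c / m = -(r * c / m) := by ring
  linarith

theorem snd_nonneg (hm : 1 < m) (h : IsRadialFlow m φ ρ u v) (hφ : ∀ t, 0 ≤ φ t) {r : ℝ}
    (hr : r ∈ Icc 0 ρ) : 0 ≤ v r := by
  simpa using h.le_snd_of_le hm (c := 0) (fun s _ => hφ _) hr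

theorem monotoneOn_fst (hm : 1 < m) (h : IsRadialFlow m φ ρ u v) (hφ : ∀ t, 0 ≤ φ t) :
    MonotoneOn u (Icc 0 ρ) :=
  monotoneOn_Icc_of_hasDerivAt_nonneg h.continuousOn_fst h.hasDerivAt_fst
    (fun _ hs => h.snd_nonneg hm hφ (Ioo_subset_Icc_self hs))

theorem le_snd (hm : 1 < m) (h : IsRadialFlow m φ ρ u v) (hφ : ∀ t, 0 ≤ φ t)
    (hmono : Monotone φ) {r : ℝ} (hr : r ∈ Icc 0 ρ) : r * φ (u 0) / m ≤ v r :=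
  h.le_snd_of_le hm (fun _ hs => hmono (h.monotoneOn_fst hm hφ
    ⟨le_rfl, hr.1.trans hr.2⟩ (Ioo_subset_Icc_self hs) hs.1.le)) hr

theorem snd_le (hm : 1 < m) (h : IsRadialFlow m φ ρ u v) (hφ : ∀ t, 0 ≤ φ t)
    (hmono : Monotone φ) {r : ℝ} (hr : r ∈ Icc 0 ρ) : v r ≤ r * φ (u r) / m :=
  (h.mono hr.2).snd_le_of_le hm (fun _ hs => hmono (h.monotoneOn_fst hm hφ
    ⟨hs.1.le, hs.2.le.trans hr.2⟩ hr hs.2.le)) ⟨hr.1, le_rfl⟩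

theorem snd_pos (hm : 1 < m) (h : IsRadialFlow m φ ρ u v) (hφ : ∀ t, 0 ≤ φ t)
    (hmono : Monotone φ) (h0 : 0 < φ (u 0)) {r : ℝ} (hr : r ∈ Ioc 0 ρ) : 0 < v r :=
  (div_pos (mul_pos hr.1 h0) (by linarith)).trans_le
    (h.le_snd hm hφ hmono (Ioc_subset_Icc_self hr))

theorem strictMonoOn_fst (hm : 1 < m) (h : IsRadialFlow m φ ρ u v) (hφ : ∀ t, 0 ≤ φ t)
    (hmono : Monotone φ) (h0 : 0 < φ (u 0)) : StrictMonoOn u (Icc 0 ρ) :=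
  strictMonoOn_of_hasDerivWithinAt_pos (convex_Icc 0 ρ) h.continuousOn_fst
    (fun x hx => (h.hasDerivAt_fst x (by simpa using hx)).hasDerivWithinAt)
    (fun x hx => h.snd_pos hm hφ hmono h0 (Ioo_subset_Ioc_self (by simpa using hx)))

theorem continuousOn_energy (h : IsRadialFlow m φ ρ u v) (hcont : Continuous φ) (c : ℝ) :
    ContinuousOn (fun s => v s ^ 2 - c * ∫ t in u 0..u s, φ t) (Icc 0 ρ) := by
  refine (h.continuousOn_snd.pow 2).sub (continuousOn_const.mul ?_)
  exact (intervalIntegral.continuous_primitive (fun _ _ => hcont.intervalIntegrable _ _)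
    _).comp_continuousOn h.continuousOn_fst

theorem hasDerivAt_energy (h : IsRadialFlow m φ ρ u v) (hcont : Continuous φ) (c : ℝ) {r : ℝ}
    (hr : r ∈ Ioo 0 ρ) :
    HasDerivAt (fun s => v s ^ 2 - c * ∫ t in u 0..u s, φ t)
      (v r * (2 * (φ (u r) - (m - 1) / r * v r) - c * φ (u r))) r := by
  have h1 := (h.hasDerivAt_snd r hr).pow 2
  have h2 := ((hcont.integral_hasStrictDerivAt (u 0) (u r)).hasDerivAt.comp r
    (h.hasDerivAt_fst r hr)).const_mul c
  exact (h1.sub h2).congr_deriv (by simp; ring)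

theorem mul_integral_le_sq_snd (hm : 1 < m) (h : IsRadialFlow m φ ρ u v) (hφ : ∀ t, 0 ≤ φ t)
    (hmono : Monotone φ) (hcont : Continuous φ) {r : ℝ} (hr : r ∈ Icc 0 ρ) :
    2 / m * ∫ t in u 0..u r, φ t ≤ v r ^ 2 := by
  have := monotoneOn_Icc_of_hasDerivAt_nonneg (h.continuousOn_energy hcont (2 / m))
    (fun s hs => h.hasDerivAt_energy hcont (2 / m) hs) (fun s hs => by
      have hs' := Ioo_subset_Icc_self hs
      refine mul_nonneg (h.snd_nonneg hm hφ hs') ?_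
      have h1 := h.snd_le hm hφ hmono hs'
      have h2 : (m - 1) / s * v s ≤ (m - 1) / s * (s * φ (u s) / m) :=
        mul_le_mul_of_nonneg_left h1 (div_nonneg (by linarith) hs.1.le)
      have h3 : (m - 1) / s * (s * φ (u s) / m) = φ (u s) - φ (u s) / m := by
        have := hs.1.ne'
        field_simp
      have h4 : 2 / m * φ (u s) = 2 * (φ (u s) / m) := by ring
      linarith) ⟨le_rfl, hr.1.trans hr.2⟩ hr hr.1
  simpa [h.snd_zero] using this

theorem sq_snd_le_mul_integral (hm : 1 < m) (h : IsRadialFlow m φ ρ u v) (hφ : ∀ t, 0 ≤ φ t)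
    (hcont : Continuous φ) {r : ℝ} (hr : r ∈ Icc 0 ρ) :
    v r ^ 2 ≤ 2 * ∫ t in u 0..u r, φ t := by
  have := monotoneOn_Icc_of_hasDerivAt_nonneg (h.continuousOn_energy hcont 2).neg
    (fun s hs => (h.hasDerivAt_energy hcont 2 hs).neg) (fun s hs => by
      have h1 := h.snd_nonneg hm hφ (Ioo_subset_Icc_self hs)
      have h2 : 0 ≤ (m - 1) / s := div_nonneg (by linarith) hs.1.le
      have h3 : 0 ≤ 2 * ((m - 1) / s * (v s * v s)) := by positivity
      linarith) ⟨le_rfl, hr.1.trans hr.2⟩ hr hr.1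
  simpa [h.snd_zero] using this

theorem lintegral_image (hm : 1 < m) (h : IsRadialFlow m φ ρ u v) (hφ : ∀ t, 0 ≤ φ t)
    (hmono : Monotone φ) (h0 : 0 < φ (u 0)) (hρ : 0 ≤ ρ) (G : ℝ → ℝ≥0∞) :
    ∫⁻ t in Ioo (u 0) (u ρ), G t = ∫⁻ r in Ioo 0 ρ, ENNReal.ofReal (v r) * G (u r) := by
  have hst := h.strictMonoOn_fst hm hφ hmono h0
  have himg : u '' Ioo 0 ρ = Ioo (u 0) (u ρ) := by
    refine subset_antisymm ?_ (intermediate_value_Ioo hρ h.continuousOn_fst)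
    rintro _ ⟨r, hr, rfl⟩
    exact ⟨hst ⟨le_rfl, hρ⟩ (Ioo_subset_Icc_self hr) hr.1,
      hst (Ioo_subset_Icc_self hr) ⟨hρ, le_rfl⟩ hr.2⟩
  rw [← himg, lintegral_image_eq_lintegral_abs_deriv_mul measurableSet_Ioo
    (fun x hx => (h.hasDerivAt_fst x hx).hasDerivWithinAt)
    (hst.injOn.mono Ioo_subset_Icc_self)]
  refine setLIntegral_congr_fun measurableSet_Ioo (fun r hr => ?_)
  rw [abs_of_nonneg (h.snd_nonneg hm hφ (Ioo_subset_Icc_self hr))]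

theorem lintegral_le (hm : 1 < m) (h : IsRadialFlow m φ ρ u v) (hφ : ∀ t, 0 ≤ φ t)
    (hmono : Monotone φ) (hcont : Continuous φ) (h0 : 0 < φ (u 0)) (hρ : 0 ≤ ρ) :
    ∫⁻ t in Ioo (u 0) (u ρ), (ENNReal.ofReal (√(∫ s in u 0..t, φ s)))⁻¹ ≤
      ENNReal.ofReal (√2) * ENNReal.ofReal ρ := by
  rw [h.lintegral_image hm hφ hmono h0 hρ]
  calc _ ≤ ∫⁻ _ in Ioo 0 ρ, ENNReal.ofReal (√2) := by
        refine setLIntegral_mono' measurableSet_Ioo (fun r hr => ?_)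
        rw [← div_eq_mul_inv]
        refine ENNReal.div_le_of_le_mul ?_
        rw [← ENNReal.ofReal_mul (by positivity), ← Real.sqrt_mul (by norm_num)]
        exact ENNReal.ofReal_le_ofReal
          (Real.le_sqrt_of_sq_le (h.sq_snd_le_mul_integral hm hφ hcont (Ioo_subset_Icc_self hr)))
    _ = _ := by simp

theorem le_lintegral (hm : 1 < m) (h : IsRadialFlow m φ ρ u v) (hφ : ∀ t, 0 ≤ φ t)
    (hmono : Monotone φ) (hcont : Continuous φ) (h0 : 0 < φ (u 0)) (hρ : 0 ≤ ρ) :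
    ENNReal.ofReal (√2) * ENNReal.ofReal ρ ≤ ENNReal.ofReal (√m) *
      ∫⁻ t in Ioo (u 0) (u ρ), (ENNReal.ofReal (√(∫ s in u 0..t, φ s)))⁻¹ := by
  rw [h.lintegral_image hm hφ hmono h0 hρ, ← lintegral_const_mul' _ _ ENNReal.ofReal_ne_top]
  calc _ = ∫⁻ _ in Ioo 0 ρ, ENNReal.ofReal (√2) := by simp
    _ ≤ _ := by
        refine setLIntegral_mono' measurableSet_Ioo (fun r hr => ?_)
        have hr' := Ioo_subset_Icc_self hr
        have hv := h.snd_pos hm hφ hmono h0 (Ioo_subset_Ioc_self hr)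
        have hm0 : 0 < m := by linarith
        have hs : √2 * √(∫ t in u 0..u r, φ t) ≤ √m * v r := by
          rw [← Real.sqrt_mul (by norm_num), ← Real.sqrt_sq hv.le, ← Real.sqrt_mul hm0.le]
          refine Real.sqrt_le_sqrt ?_
          have := mul_le_mul_of_nonneg_left
            (h.mul_integral_le_sq_snd hm hφ hmono hcont hr') hm0.le
          rwa [← mul_assoc, mul_div_cancel₀ _ hm0.ne'] at this
        rw [← mul_assoc, ← div_eq_mul_inv, ENNReal.le_div_iff_mul_le
          (Or.inr (by simp [hm0, hv])) (Or.inr (by finiteness)),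
          ← ENNReal.ofReal_mul (by positivity), ← ENNReal.ofReal_mul (by positivity)]
        exact ENNReal.ofReal_le_ofReal hs

end IsRadialFlow

/-- The weighted average `∫₀¹ σ ^ (m-1) h(sσ) dσ`; for `s > 0` it equals
`s ^ (-m) ∫₀ˢ t ^ (m-1) h(t) dt`. -/
def radialAvg (m : ℝ) (h : ℝ → ℝ) (s : ℝ) : ℝ := ∫ σ in (0 : ℝ)..1, σ ^ (m - 1) * h (s * σ)

section RadialAvg

variable {m : ℝ} {h : ℝ → ℝ}

theorem continuous_radialAvg (hm : 1 < m) (hh : Continuous h) : Continuous (radialAvg m h) := by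
  have : Continuous fun x : ℝ => x ^ (m - 1) := Real.continuous_rpow_const (by linarith)
  refine intervalIntegral.continuous_parametric_intervalIntegral_of_continuous' ?_ 0 1
  exact (this.comp continuous_snd).mul (hh.comp (continuous_fst.mul continuous_snd))

theorem radialAvg_zero (hm : 1 < m) : radialAvg m h 0 = h 0 / m := by
  simp only [radialAvg, zero_mul, intervalIntegral.integral_mul_const]
  rw [integral_rpow (Or.inl (by linarith))]
  simp [Real.zero_rpow (by linarith : m ≠ 0), div_eq_inv_mul]

theorem radialAvg_neg (he : ∀ x, h (-x) = h x) (s : ℝ) : radialAvg m h (-s) = radialAvg m h s := by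
  simp [radialAvg, neg_mul, he]

theorem abs_integrand_radialAvg_le (hm : 1 < m) {B : ℝ} (hB : ∀ x, |h x| ≤ B) (s : ℝ) {σ : ℝ}
    (hσ : σ ∈ uIoc (0 : ℝ) 1) : |σ ^ (m - 1) * h (s * σ)| ≤ B := by
  rw [uIoc_of_le zero_le_one] at hσ
  rw [abs_mul, abs_of_nonneg (Real.rpow_nonneg hσ.1.le _)]
  exact (mul_le_of_le_one_left (abs_nonneg _)
    (Real.rpow_le_one hσ.1.le hσ.2 (by linarith))).trans (hB _)

theorem abs_radialAvg_le (hm : 1 < m) {B : ℝ} (hB : ∀ x, |h x| ≤ B) (s : ℝ) :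
    |radialAvg m h s| ≤ B := by
  simpa [radialAvg] using intervalIntegral.norm_integral_le_of_norm_le_const (a := 0) (b := 1)
    (f := fun σ => σ ^ (m - 1) * h (s * σ)) (fun σ hσ => abs_integrand_radialAvg_le hm hB s hσ)

theorem radialAvg_mono (hm : 1 < m) {k : ℝ → ℝ} (hh : Continuous h) (hk : Continuous k)
    (hle : ∀ x, h x ≤ k x) (s : ℝ) : radialAvg m h s ≤ radialAvg m k s := by
  have hc : Continuous fun x : ℝ => x ^ (m - 1) := Real.continuous_rpow_const (by linarith)
  refine intervalIntegral.integral_mono_on zero_le_one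
    (Continuous.intervalIntegrable (by fun_prop) _ _)
    (Continuous.intervalIntegrable (by fun_prop) _ _) (fun σ hσ => ?_)
  exact mul_le_mul_of_nonneg_left (hle _) (Real.rpow_nonneg hσ.1 _)

theorem tendsto_radialAvg (hm : 1 < m) {H : ℕ → ℝ → ℝ} {B : ℝ} (hH : ∀ n, Continuous (H n))
    (hB : ∀ n x, |H n x| ≤ B) (hlim : ∀ x, Tendsto (fun n => H n x) atTop (𝓝 (h x))) (s : ℝ) :
    Tendsto (fun n => radialAvg m (H n) s) atTop (𝓝 (radialAvg m h s)) := by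
  have hc : Continuous fun x : ℝ => x ^ (m - 1) := Real.continuous_rpow_const (by linarith)
  refine intervalIntegral.tendsto_integral_filter_of_dominated_convergence (fun _ => B)
    (Eventually.of_forall fun n => ?_)
    (Eventually.of_forall fun n => Eventually.of_forall fun σ hσ =>
      abs_integrand_radialAvg_le hm (hB n) s hσ) (by simp)
    (Eventually.of_forall fun σ _ => (hlim _).const_mul _)
  have := hH n
  exact Continuous.aestronglyMeasurable (by fun_prop)

theorem hasDerivAt_mul_radialAvg_of_pos (hm : 1 < m) (hh : Continuous h) {s : ℝ} (hs : 0 < s) :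
    HasDerivAt (fun x => x * radialAvg m h x) (h s - (m - 1) * radialAvg m h s) s := by
  have hc : Continuous fun x : ℝ => x ^ (m - 1) := Real.continuous_rpow_const (by linarith)
  have key : ∀ x : ℝ, 0 < x →
      x ^ (m - 1) * (x * radialAvg m h x) = ∫ t in (0 : ℝ)..x, t ^ (m - 1) * h t := by
    intro x hx
    have := intervalIntegral.mul_integral_comp_mul_left (a := 0) (b := 1)
      (f := fun t => t ^ (m - 1) * h t) x
    rw [mul_zero, mul_one] at this
    rw [← this, radialAvg, mul_left_comm, ← intervalIntegral.integral_const_mul]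
    congr 1
    refine intervalIntegral.integral_congr (fun σ hσ => ?_)
    rw [uIcc_of_le zero_le_one] at hσ
    rw [Real.mul_rpow hx.le hσ.1]
    ring
  have h1 := (Real.hasDerivAt_rpow_const (x := s) (p := 1 - m) (Or.inl hs.ne')).mul
    (((hc.mul hh).integral_hasStrictDerivAt 0 s).hasDerivAt)
  have e : s ^ (1 - m) * s ^ (m - 1) = 1 := by
    rw [← Real.rpow_add hs]; simp
  have e2 : s ^ (1 - m - 1) * s ^ (m - 1) = s⁻¹ := by
    rw [← Real.rpow_add hs, ← Real.rpow_neg_one]; congr 1; ring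
  refine (h1.congr_of_eventuallyEq ?_).congr_deriv ?_
  · filter_upwards [lt_mem_nhds hs] with x hx
    simp only [Pi.mul_apply]
    rw [← key x hx, ← mul_assoc, ← Real.rpow_add hx]
    simp
  · simp only [Pi.mul_apply]
    rw [← key s hs]
    have : (1 - m) * s ^ (1 - m - 1) * (s ^ (m - 1) * (s * radialAvg m h s)) =
        (1 - m) * (s ^ (1 - m - 1) * s ^ (m - 1)) * (s * radialAvg m h s) := by ring
    rw [this, e2, ← mul_assoc (s ^ (1 - m)), e]
    field_simp
    ring

theorem hasDerivAt_mul_radialAvg (hm : 1 < m) (hh : Continuous h) (he : ∀ x, h (-x) = h x)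
    (s : ℝ) :
    HasDerivAt (fun x => x * radialAvg m h x) (h s - (m - 1) * radialAvg m h s) s := by
  rcases lt_trichotomy s 0 with hs | rfl | hs
  · have h1 := hasDerivAt_mul_radialAvg_of_pos hm hh (neg_pos.2 hs)
    have h2 := (h1.comp s (hasDerivAt_neg s)).neg
    refine (h2.congr_of_eventuallyEq (Eventually.of_forall fun x => ?_)).congr_deriv ?_
    · simp [radialAvg_neg he]
    · rw [he, radialAvg_neg he]; ring
  · have hv : h 0 - (m - 1) * radialAvg m h 0 = radialAvg m h 0 := by
      rw [radialAvg_zero hm]; field_simp; ring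
    rw [hv, hasDerivAt_iff_tendsto_slope]
    refine (((continuous_radialAvg hm hh).tendsto 0).mono_left nhdsWithin_le_nhds).congr' ?_
    filter_upwards [self_mem_nhdsWithin] with x hx
    have : x ≠ 0 := hx
    simp [slope_def_field, this]
  · exact hasDerivAt_mul_radialAvg_of_pos hm hh hs

end RadialAvg

/-- The integral operator whose fixed points are the even solutions of the radial equation. -/
def radialOp (m : ℝ) (g : ℝ → ℝ) (a : ℝ) (u : ℝ → ℝ) (r : ℝ) : ℝ :=
  a + ∫ s in (0 : ℝ)..|r|, s * radialAvg m (fun x => g (u x)) s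

section RadialOp

variable {m a B : ℝ} {g : ℝ → ℝ}

theorem continuous_radialOp (hm : 1 < m) (hg : Continuous g) {u : ℝ → ℝ} (hu : Continuous u) :
    Continuous (radialOp m g a u) := by
  have hc : Continuous (radialAvg m fun x => g (u x)) := continuous_radialAvg hm (hg.comp hu)
  exact continuous_const.add ((intervalIntegral.continuous_primitive
    (fun _ _ => (continuous_id.mul hc).intervalIntegrable _ _) 0).comp continuous_abs)

theorem radialOp_mono (hm : 1 < m) (hg : Continuous g) (hmono : Monotone g) {u w : ℝ → ℝ}
    (hu : Continuous u) (hw : Continuous w) (hle : ∀ x, u x ≤ w x) (r : ℝ) :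
    radialOp m g a u r ≤ radialOp m g a w r := by
  have hc : Continuous (radialAvg m fun x => g (u x)) := continuous_radialAvg hm (hg.comp hu)
  have hc' : Continuous (radialAvg m fun x => g (w x)) := continuous_radialAvg hm (hg.comp hw)
  refine add_le_add le_rfl (intervalIntegral.integral_mono_on (abs_nonneg r)
    ((continuous_id.mul hc).intervalIntegrable _ _)
    ((continuous_id.mul hc').intervalIntegrable _ _) (fun s hs => ?_))
  exact mul_le_mul_of_nonneg_left
    (radialAvg_mono hm (hg.comp hu) (hg.comp hw) (fun x => hmono (hle x)) s) hs.1

theorem radialOp_le (hm : 1 < m) (hB : ∀ x, |g x| ≤ B) (u : ℝ → ℝ) (r : ℝ) :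
    radialOp m g a u r ≤ a + |r| * B * |r| := by
  have := intervalIntegral.norm_integral_le_of_norm_le_const (a := 0) (b := |r|) (C := |r| * B)
    (f := fun s => s * radialAvg m (fun x => g (u x)) s) (fun s hs => by
      rw [uIoc_of_le (abs_nonneg r)] at hs
      rw [Real.norm_eq_abs, abs_mul, abs_of_pos hs.1]
      exact mul_le_mul hs.2 (abs_radialAvg_le hm (fun x => hB _) s) (abs_nonneg _)
        (abs_nonneg _))
  rw [sub_zero, abs_abs] at this
  exact add_le_add le_rfl ((le_abs_self _).trans this)

theorem le_radialOp (hg0 : ∀ x, 0 ≤ g x) {u : ℝ → ℝ}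
    (r : ℝ) : a ≤ radialOp m g a u r := by
  refine le_add_of_nonneg_right (intervalIntegral.integral_nonneg (abs_nonneg r) fun s hs =>
    mul_nonneg hs.1 (intervalIntegral.integral_nonneg zero_le_one fun σ hσ =>
      mul_nonneg (Real.rpow_nonneg hσ.1 _) (hg0 _)))

theorem exists_continuous_radialOp_fixed (hm : 1 < m) (hg : Continuous g) (hmono : Monotone g)
    (hg0 : ∀ x, 0 ≤ g x) (hB : ∀ x, g x ≤ B) :
    ∃ u : ℝ → ℝ, Continuous u ∧ radialOp m g a u = u := by
  have hB' : ∀ x, |g x| ≤ B := fun x => by rw [abs_of_nonneg (hg0 x)]; exact hB x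
  let U : ℕ → ℝ → ℝ := fun n => (radialOp m g a)^[n] (fun _ => a)
  have hUs : ∀ n, U (n + 1) = radialOp m g a (U n) := fun n =>
    Function.iterate_succ_apply' _ _ _
  have hUc : ∀ n, Continuous (U n) := by
    intro n
    induction n with
    | zero => exact continuous_const
    | succ n ih => rw [hUs]; exact continuous_radialOp hm hg ih
  have hstep : ∀ n x, U n x ≤ U (n + 1) x := by
    intro n
    induction n with
    | zero => exact fun x => by rw [hUs]; exact le_radialOp hg0 x
    | succ n ih =>
      intro x
      rw [hUs (n + 1)]
      conv_lhs => rw [hUs n]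
      exact radialOp_mono hm hg hmono (hUc _) (hUc _) ih x
  have hbdd : ∀ x, BddAbove (range fun n => U n x) := by
    intro x
    refine ⟨a + |x| * B * |x|, ?_⟩
    rintro _ ⟨n, rfl⟩
    refine (hstep n x).trans ?_
    rw [hUs]
    exact radialOp_le hm hB' _ x
  let u : ℝ → ℝ := fun x => ⨆ n, U n x
  have hlim : ∀ x, Tendsto (fun n => U n x) atTop (𝓝 (u x)) := fun x =>
    tendsto_atTop_ciSup (monotone_nat_of_le_succ fun n => hstep n x) (hbdd x)
  have havg : ∀ s, Tendsto (fun n => radialAvg m (fun x => g (U n x)) s) atTop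
      (𝓝 (radialAvg m (fun x => g (u x)) s)) :=
    tendsto_radialAvg hm (fun n => hg.comp (hUc n)) (fun n x => hB' _)
      (fun x => (hg.tendsto _).comp (hlim x))
  have hfix : radialOp m g a u = u := by
    funext r
    refine tendsto_nhds_unique (f := fun n => U (n + 1) r) (l := atTop) ?_
      ((tendsto_add_atTop_iff_nat 1).2 (hlim r))
    simp only [hUs]
    refine tendsto_const_nhds.add
      (intervalIntegral.tendsto_integral_filter_of_dominated_convergence (fun _ => |r| * B)
        (Eventually.of_forall fun n => ?_) (Eventually.of_forall fun n =>
          Eventually.of_forall fun s hs => ?_) (by simp)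
        (Eventually.of_forall fun s _ => (havg s).const_mul s))
    · exact (continuous_id.mul
        (continuous_radialAvg hm (hg.comp (hUc n)))).aestronglyMeasurable
    · rw [uIoc_of_le (abs_nonneg r)] at hs
      rw [Real.norm_eq_abs, abs_mul, abs_of_pos hs.1]
      exact mul_le_mul hs.2 (abs_radialAvg_le hm (fun x => hB' _) s) (abs_nonneg _)
        (abs_nonneg _)
  refine ⟨u, ?_, hfix⟩
  have hmeas : Measurable (radialAvg m fun x => g (u x)) :=
    measurable_of_tendsto_metrizable
      (fun n => (continuous_radialAvg hm (hg.comp (hUc n))).measurable) (tendsto_pi_nhds.2 havg)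
  have hint : ∀ b c, IntervalIntegrable (fun s => s * radialAvg m (fun x => g (u x)) s)
      volume b c := fun b c => by
    refine IntervalIntegrable.continuousOn_mul ?_ continuousOn_id
    exact (intervalIntegrable_const (c := B)).mono_fun hmeas.aestronglyMeasurable
      (Eventually.of_forall fun s =>
        (abs_radialAvg_le hm (fun x => hB' _) s).trans (le_abs_self B))
  rw [← hfix]
  exact continuous_const.add
    ((intervalIntegral.continuous_primitive hint 0).comp continuous_abs)

/-- Global solvability of the radial equation for a bounded monotone nonlinearity. -/
theorem exists_global_radial_solution (hm : 1 < m) (hg : Continuous g) (hmono : Monotone g)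
    (hg0 : ∀ x, 0 ≤ g x) (hB : ∀ x, g x ≤ B) :
    ∃ w v : ℝ → ℝ, w 0 = a ∧ ContDiff ℝ 2 w ∧ (∀ r, HasDerivAt w (v r) r) ∧
      ∀ ρ, IsRadialFlow m g ρ w v := by
  obtain ⟨u, hu, hfix⟩ := exists_continuous_radialOp_fixed (a := a) hm hg hmono hg0 hB
  set h : ℝ → ℝ := fun x => g (u x) with hh
  have hc : Continuous h := hg.comp hu
  have hev : ∀ x, h (-x) = h x := fun x => by
    simp only [hh]
    rw [← hfix]
    simp [radialOp]
  have hA := continuous_radialAvg hm hc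
  set w : ℝ → ℝ := fun r => a + ∫ s in (0 : ℝ)..r, s * radialAvg m h s with hw
  have hwu : ∀ r, 0 ≤ r → w r = u r := fun r hr => by
    rw [← hfix]; simp [hw, radialOp, abs_of_nonneg hr, hh]
  have hw' : ∀ r, HasDerivAt w (r * radialAvg m h r) r := fun r =>
    ((continuous_id.mul hA).integral_hasStrictDerivAt 0 r).hasDerivAt.const_add a
  have hv' := hasDerivAt_mul_radialAvg hm hc hev
  have hdw : deriv w = fun r => r * radialAvg m h r := funext fun r => (hw' r).deriv
  refine ⟨w, fun r => r * radialAvg m h r, by simp [hw], ?_, hw', fun ρ => ?_⟩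
  · rw [show (2 : WithTop ℕ∞) = 1 + 1 by norm_num, contDiff_succ_iff_deriv]
    refine ⟨fun r => (hw' r).differentiableAt, by simp, ?_⟩
    rw [hdw, contDiff_one_iff_deriv]
    refine ⟨fun r => (hv' r).differentiableAt, ?_⟩
    rw [funext fun r => (hv' r).deriv]
    fun_prop
  · refine ⟨fun r _ => (hw' r).continuousAt.continuousWithinAt,
      fun r _ => (hv' r).continuousAt.continuousWithinAt, by simp, fun r _ => hw' r,
      fun r hr => (hv' r).congr_deriv ?_⟩
    rw [hwu r hr.1.le]
    have := hr.1.ne'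
    field_simp
    rfl

end RadialOp

theorem odeDom_eq (R : ℝ≥0∞) : odeDom R = Ici 0 ∩ {r : ℝ | ENNReal.ofReal r < R} := rfl

theorem isOpen_ofReal_lt (R : ℝ≥0∞) : IsOpen {r : ℝ | ENNReal.ofReal r < R} :=
  isOpen_lt ENNReal.continuous_ofReal continuous_const

theorem IsSolOn.exists_isRadialFlow {m a ρ : ℝ} {φ ψ u : ℝ → ℝ} {R : ℝ≥0∞}
    (h : IsSolOn m φ a R u) (hψ : ∀ t, 0 ≤ t → ψ t = φ t) (hρ : ENNReal.ofReal ρ < R)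
    (hR : 0 < R) : ∃ v, IsRadialFlow m ψ ρ u v := by
  obtain ⟨hC, hnn, -, h0, hode⟩ := h
  have hU := isOpen_ofReal_lt R
  have hud : UniqueDiffOn ℝ (odeDom R) := (uniqueDiffOn_Ici 0).inter hU
  have hsub : Icc 0 ρ ⊆ odeDom R := fun r hr =>
    ⟨hr.1, (ENNReal.ofReal_le_ofReal hr.2).trans_lt hρ⟩
  have hnhds : ∀ r ∈ Ioo 0 ρ, odeDom R ∈ 𝓝 r := fun r hr =>
    inter_mem (Ici_mem_nhds hr.1) (hU.mem_nhds (hsub (Ioo_subset_Icc_self hr)).2)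
  have hC' : ContDiffOn ℝ 1 (derivWithin u (odeDom R)) (odeDom R) :=
    hC.derivWithin hud (by norm_num)
  refine ⟨derivWithin u (odeDom R), hC.continuousOn.mono hsub, hC'.continuousOn.mono hsub, ?_,
    fun r hr => ?_, fun r hr => ?_⟩
  · rw [odeDom_eq, derivWithin_inter (hU.mem_nhds (by simpa using hR)), h0]
  · rw [derivWithin_of_mem_nhds (hnhds r hr)]
    exact ((hC.differentiableOn (by norm_num)).differentiableAt (hnhds r hr)).hasDerivAt
  · have hd := ((hC'.differentiableOn (by norm_num)).differentiableAt (hnhds r hr)).hasDerivAt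
    have hev : derivWithin u (odeDom R) =ᶠ[𝓝 r] deriv u := by
      filter_upwards [Ioo_mem_nhds hr.1 hr.2] with s hs
      exact derivWithin_of_mem_nhds (hnhds s hs)
    have hmem := hsub (Ioo_subset_Icc_self hr)
    refine hd.congr_deriv ?_
    rw [hev.deriv_eq, hev.self_of_nhds, hψ _ (hnn r hmem)]
    linarith [hode r hr.1 hmem.2]

/-- The Keller–Osserman integral diverges at an equilibrium, by the local Lipschitz bound. -/
theorem lintegral_inv_sqrt_integral_eq_top {ψ : ℝ → ℝ} {a b K : ℝ} (hcont : Continuous ψ)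
    (hab : a < b) (hK : 0 < K) (hle : ∀ s ∈ Ico a b, ψ s ≤ K * (s - a)) :
    ∫⁻ t in Ioi a, (ENNReal.ofReal (√(∫ s in a..t, ψ s)))⁻¹ = ⊤ := by
  have hpt : ∀ t ∈ Ioo a b, ‖(√K)⁻¹ * (t - a)⁻¹‖ₑ ≤
      (ENNReal.ofReal (√(∫ s in a..t, ψ s)))⁻¹ := by
    intro t ht
    have hta : 0 < t - a := sub_pos.2 ht.1
    have hint : ∫ s in a..t, ψ s ≤ K * (t - a) ^ 2 := by
      calc ∫ s in a..t, ψ s ≤ ∫ s in a..t, K * (t - a) := by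
            refine intervalIntegral.integral_mono_on ht.1.le (hcont.intervalIntegrable _ _)
              (by simp) (fun s hs => (hle s ⟨hs.1, hs.2.trans_lt ht.2⟩).trans ?_)
            exact mul_le_mul_of_nonneg_left (by linarith [hs.2]) hK.le
        _ = K * (t - a) ^ 2 := by
            rw [intervalIntegral.integral_const, smul_eq_mul]; ring
    have hsq : √(∫ s in a..t, ψ s) ≤ √K * (t - a) := by
      refine (Real.sqrt_le_sqrt hint).trans_eq ?_
      rw [Real.sqrt_mul hK.le, Real.sqrt_sq hta.le]
    have hpos : 0 < √K * (t - a) := mul_pos (Real.sqrt_pos.2 hK) hta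
    rw [← mul_inv, Real.enorm_of_nonneg (inv_nonneg.2 hpos.le), ENNReal.ofReal_inv_of_pos hpos]
    exact ENNReal.inv_le_inv.2 (ENNReal.ofReal_le_ofReal hsq)
  by_contra hne
  have hni : ¬ IntervalIntegrable (fun t => (t - a)⁻¹) volume a b := by
    rw [intervalIntegrable_sub_inv_iff]
    simp [hab.ne]
  refine hni ?_
  have hI : IntegrableOn (fun t => (√K)⁻¹ * (t - a)⁻¹) (Ioo a b) := by
    refine ⟨by fun_prop, ?_⟩
    refine lt_of_le_of_lt ?_ (lt_top_iff_ne_top.2 hne)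
    exact (setLIntegral_mono' measurableSet_Ioo hpt).trans
      (lintegral_mono_set Ioo_subset_Ioi_self)
  rw [intervalIntegrable_iff_integrableOn_Ioo_of_le hab.le]
  refine (hI.const_mul (√K)).congr (Eventually.of_forall fun t => ?_)
  simp [(Real.sqrt_pos.2 hK).ne']

theorem maxRadius_eq_top_of_eq_zero {m a : ℝ} {φ : ℝ → ℝ} (ha : 0 ≤ a) (h : φ a = 0) :
    maxRadius m φ a = ⊤ := by
  refine top_unique (le_sSup ⟨ENNReal.zero_lt_top, fun _ => a, contDiffOn_const,
    fun _ _ => ha, rfl, by simp, fun r _ _ => by simp [h]⟩)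

/-- The solution of the equation truncated at level `M` reaches `M` at some radius, which bounds
the maximal radius from below. -/
theorem lintegral_Ioo_le_maxRadius {m a M : ℝ} {φ ψ : ℝ → ℝ} (hm : 1 < m)
    (hψ : ∀ t, 0 ≤ t → ψ t = φ t) (hψ0 : ∀ t, 0 ≤ ψ t) (hmono : Monotone ψ)
    (hcont : Continuous ψ) (ha : 0 ≤ a) (hpos : 0 < ψ a) (hM : a < M) :
    ∫⁻ t in Ioo a M, (ENNReal.ofReal (√(∫ s in a..t, ψ s)))⁻¹ ≤
      ENNReal.ofReal (√2) * maxRadius m φ a := by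
  set g : ℝ → ℝ := fun t => ψ (min t M) with hg
  have hgc : Continuous g := hcont.comp (continuous_id.min continuous_const)
  have hgm : Monotone g := fun x y hxy => hmono (min_le_min_right M hxy)
  have hg0 : ∀ x, 0 ≤ g x := fun x => hψ0 _
  have hgψ : ∀ t, t ≤ M → g t = ψ t := fun t ht => by simp [hg, ht]
  obtain ⟨w, v, hw0, hwC, hw', hflow⟩ :=
    exists_global_radial_solution (a := a) hm hgc hgm hg0 (fun x => hmono (min_le_right x M))
  have hga : 0 < g (w 0) := by rw [hw0, hgψ a hM.le]; exact hpos
  have hcw : Continuous w := hwC.continuous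
  have hreach : ∃ L, 0 ≤ L ∧ M ≤ w L := by
    set c := g (w 0) / m with hc
    have hc0 : 0 < c := div_pos hga (by linarith)
    set L := 1 + (M - a) / c with hL
    have hL1 : 1 ≤ L := le_add_of_nonneg_right (div_nonneg (by linarith) hc0.le)
    refine ⟨L, by linarith, ?_⟩
    have hmon : MonotoneOn (fun r => w r - c * r) (Icc 1 L) :=
      monotoneOn_Icc_of_hasDerivAt_nonneg (f' := fun r => v r - c) (by fun_prop)
        (fun r _ => ((hw' r).sub ((hasDerivAt_id r).const_mul c)).congr_deriv (by simp))
        (fun r hr => by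
          have h1 := (hflow L).le_snd hm hg0 hgm (r := r) ⟨by linarith [hr.1], hr.2.le⟩
          have h2 : c ≤ r * g (w 0) / m := by
            rw [mul_div_assoc]; exact le_mul_of_one_le_left hc0.le hr.1.le
          linarith)
    have h1 := hmon ⟨le_rfl, hL1⟩ ⟨hL1, le_rfl⟩ hL1
    have h2 := (hflow L).monotoneOn_fst hm hg0 ⟨le_rfl, by linarith⟩
      (⟨zero_le_one, hL1⟩ : (1 : ℝ) ∈ Icc 0 L) zero_le_one
    have h3 : c * L = c + (M - a) := by rw [hL]; field_simp
    simp only at h1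
    linarith
  obtain ⟨L, hL0, hLM⟩ := hreach
  obtain ⟨ρ, hρ, hwρ⟩ := intermediate_value_Icc hL0 hcw.continuousOn
    (show M ∈ Icc (w 0) (w L) from ⟨hw0 ▸ hM.le, hLM⟩)
  have hρ0 : 0 < ρ := by
    refine hρ.1.lt_of_ne fun h => hM.ne ?_
    rw [← hw0, ← hwρ, ← h]
  have hmonw := (hflow ρ).monotoneOn_fst hm hg0
  have hle : ENNReal.ofReal ρ ≤ maxRadius m φ a := by
    have hrange : ∀ r ∈ Icc 0 ρ, a ≤ w r ∧ w r ≤ M := fun r hr =>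
      ⟨hw0 ▸ hmonw ⟨le_rfl, hρ0.le⟩ hr hr.1, hwρ ▸ hmonw hr ⟨hρ0.le, le_rfl⟩ hr.2⟩
    have hlt : ∀ r, 0 ≤ r → ENNReal.ofReal r < ENNReal.ofReal ρ → r ∈ Ico 0 ρ := fun r h1 h2 =>
      ⟨h1, (ENNReal.ofReal_lt_ofReal_iff hρ0).1 h2⟩
    refine le_sSup ⟨by simpa using hρ0, w, hwC.contDiffOn, fun r hr =>
      ha.trans (hrange r (Ico_subset_Icc_self (hlt r hr.1 hr.2))).1, hw0, ?_, fun r hr hrρ => ?_⟩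
    · rw [(hw' 0).hasDerivWithinAt.derivWithin (uniqueDiffOn_Ici 0 0 self_mem_Ici),
        (hflow ρ).snd_zero]
    · have hr' := hlt r hr.le hrρ
      obtain ⟨h1, h2⟩ := hrange r (Ico_subset_Icc_self hr')
      rw [funext fun s => (hw' s).deriv, ((hflow ρ).hasDerivAt_snd r ⟨hr, hr'.2⟩).deriv,
        hgψ _ h2, hψ _ (ha.trans h1)]
      ring
  have hmain := (hflow ρ).lintegral_le hm hg0 hgm hgc hga hρ0.le
  rw [hw0, hwρ] at hmain
  refine le_trans (le_of_eq ?_) (hmain.trans (mul_le_mul_right hle _))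
  refine setLIntegral_congr_fun measurableSet_Ioo (fun t ht => ?_)
  have : ∫ s in a..t, ψ s = ∫ s in a..t, g s :=
    intervalIntegral.integral_congr fun s hs => by
      rw [uIcc_of_le ht.1.le] at hs
      exact (hgψ s (hs.2.trans ht.2.le)).symm
  rw [this]

theorem lintegral_Ioi_le_of_forall_Ioo_le {f : ℝ → ℝ≥0∞} {a : ℝ} {C : ℝ≥0∞}
    (h : ∀ M, a < M → ∫⁻ t in Ioo a M, f t ≤ C) : ∫⁻ t in Ioi a, f t ≤ C := by
  have hU : Ioi a = ⋃ n : ℕ, Ioo a (a + (n + 1)) := by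
    ext t
    simp only [mem_Ioi, mem_iUnion, mem_Ioo, exists_and_left, iff_self_and]
    intro _
    obtain ⟨n, hn⟩ := exists_nat_gt (t - a)
    exact ⟨n, by linarith⟩
  rw [hU, setLIntegral_iUnion_of_directed]
  · exact iSup_le fun n => h _ (by linarith [n.cast_nonneg (α := ℝ)])
  · refine Monotone.directed_le fun i j hij => Ioo_subset_Ioo_right ?_
    have : (i : ℝ) ≤ j := by exact_mod_cast hij
    linarith

theorem maxRadius_le_lintegral {m a : ℝ} {φ ψ : ℝ → ℝ} (hm : 1 < m)
    (hψ : ∀ t, 0 ≤ t → ψ t = φ t) (hψ0 : ∀ t, 0 ≤ ψ t) (hmono : Monotone ψ)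
    (hcont : Continuous ψ) (hpos : 0 < ψ a) :
    ENNReal.ofReal (√2) * maxRadius m φ a ≤ ENNReal.ofReal (√m) *
      ∫⁻ t in Ioi a, (ENNReal.ofReal (√(∫ s in a..t, ψ s)))⁻¹ := by
  have h2 : ENNReal.ofReal (√2) ≠ 0 := by simp
  rw [mul_comm, ← ENNReal.le_div_iff_mul_le (Or.inl h2) (Or.inl ENNReal.ofReal_ne_top)]
  refine sSup_le ?_
  rintro R ⟨hR, u, hu⟩
  refine le_of_forall_lt fun c hc => ?_
  obtain ⟨d, hcd, hdR⟩ := exists_between hc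
  refine hcd.trans_le ?_
  have hd : ENNReal.ofReal d.toReal = d := ENNReal.ofReal_toReal hdR.ne_top
  obtain ⟨v, hv⟩ := hu.exists_isRadialFlow hψ (hd.symm ▸ hdR) hR
  have hu0 : u 0 = a := hu.2.2.1
  have := hv.le_lintegral hm hψ0 hmono hcont (by rwa [hu0]) ENNReal.toReal_nonneg
  rw [hd, hu0] at this
  rw [ENNReal.le_div_iff_mul_le (Or.inl h2) (Or.inl ENNReal.ofReal_ne_top), mul_comm]
  exact this.trans (mul_le_mul_right (lintegral_mono_set Ioo_subset_Ioi_self) _)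

/-- two-sided estimate of the maximal existence radius by the
Keller--Osserman integral (as extended reals). -/
theorem maxRadius_keller_osserman_bounds
    (m : ℝ) (hm : 2 < m)
    (φ : ℝ → ℝ) (hφ0 : φ 0 = 0)
    (hφmono : MonotoneOn φ (Set.Ici 0))
    (hφnonneg : ∀ t : ℝ, 0 ≤ t → 0 ≤ φ t)
    (hφlip : ∀ x ∈ Set.Ici (0 : ℝ), ∃ K : NNReal, ∃ s ∈ nhdsWithin x (Set.Ici 0),
      LipschitzOnWith K φ s)
    (a : ℝ) (ha : 0 < a) :
    (∫⁻ t in Set.Ioi a, (ENNReal.ofReal (Real.sqrt (∫ s in a..t, φ s)))⁻¹ ≤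
        ENNReal.ofReal (Real.sqrt 2) * maxRadius m φ a) ∧
      ENNReal.ofReal (Real.sqrt 2) * maxRadius m φ a ≤
        ENNReal.ofReal (Real.sqrt m) *
          ∫⁻ t in Set.Ioi a, (ENNReal.ofReal (Real.sqrt (∫ s in a..t, φ s)))⁻¹ := by
  have hcontOn : ContinuousOn φ (Ici 0) := fun x hx => by
    obtain ⟨K, s, hs, hL⟩ := hφlip x hx
    exact (hL.continuousOn x (mem_of_mem_nhdsWithin hx hs)).mono_of_mem_nhdsWithin hs
  set ψ : ℝ → ℝ := fun t => φ (max t 0) with hψdef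
  have hcont : Continuous ψ :=
    hcontOn.comp_continuous (continuous_id.max continuous_const) fun t => le_max_right t 0
  have hmono : Monotone ψ := fun x y hxy =>
    hφmono (le_max_right x 0) (le_max_right y 0) (max_le_max_right 0 hxy)
  have hψ0 : ∀ t, 0 ≤ ψ t := fun t => hφnonneg _ (le_max_right t 0)
  have hψ : ∀ t, 0 ≤ t → ψ t = φ t := fun t ht => by simp [hψdef, ht]
  have hI : ∫⁻ t in Ioi a, (ENNReal.ofReal (√(∫ s in a..t, φ s)))⁻¹ =
      ∫⁻ t in Ioi a, (ENNReal.ofReal (√(∫ s in a..t, ψ s)))⁻¹ := by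
    refine setLIntegral_congr_fun measurableSet_Ioi (fun t ht => ?_)
    have : ∫ s in a..t, φ s = ∫ s in a..t, ψ s :=
      intervalIntegral.integral_congr fun s hs => by
        rw [uIcc_of_le (le_of_lt ht)] at hs
        exact (hψ s (ha.le.trans hs.1)).symm
    rw [this]
  rw [hI]
  rcases (hψ0 a).eq_or_lt with h0 | hpos
  · have hφa : φ a = 0 := by rw [← hψ a ha.le, ← h0]
    obtain ⟨K, s, hs, hL⟩ := hφlip a ha.le
    have has : a ∈ s := mem_of_mem_nhdsWithin ha.le hs
    rw [nhdsWithin_eq_nhds.2 (Ici_mem_nhds ha)] at hs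
    obtain ⟨b, hab, hb⟩ := exists_Ico_subset_of_mem_nhds hs ⟨a + 1, by linarith⟩
    have htop := lintegral_inv_sqrt_integral_eq_top (K := K + 1) hcont hab (by positivity)
      (fun t ht => by
        have h1 := hL.dist_le_mul t (hb ht) a has
        rw [Real.dist_eq, Real.dist_eq, hφa, sub_zero, abs_of_nonneg (sub_nonneg.2 ht.1)] at h1
        rw [hψ t (ha.le.trans ht.1)]
        linarith [le_abs_self (φ t), ht.1])
    rw [htop, maxRadius_eq_top_of_eq_zero ha.le hφa, ENNReal.mul_top (by simp),
      ENNReal.mul_top (by simp; linarith)]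
    exact ⟨le_rfl, le_rfl⟩
  · exact ⟨lintegral_Ioi_le_of_forall_Ioo_le fun M hM =>
      lintegral_Ioo_le_maxRadius (by linarith) hψ hψ0 hmono hcont ha.le hpos hM,
      maxRadius_le_lintegral (by linarith) hψ hψ0 hmono hcont hpos⟩
end
end
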